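/- Let V have n even generators and n odd generators and set τ = ∑_{i=1}^n o_i∧e_i ∈ Λ̄²V. For the multiplication map L_τ: H_n^t → H_n^{t+2}, α ↦ α∧τ, the following exactness-type statement holds: ker L_τ in degree t equals Im L_τ (from degree t−2) when t ≠ n, and equals Im L_τ ⊕ F·(e₁∧⋯∧e_n) when t = n. -/

import Mathlib

noncomputable section

open TensorAlgebra

variable (F : Type) [Field F]

/-- The defining relations of the super-exterior algebra of the superspace `M₀ × M₁`
(`M₀` even, `M₁` odd): `u ⊗ v + (-1)^{|u||v|} v ⊗ u = 0`. -/
inductive SRel (M₀ M₁ : Type) [AddCommGroup M₀] [Module F M₀] [AddCommGroup M₁] [Module F M₁] :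
    TensorAlgebra F (M₀ × M₁) → TensorAlgebra F (M₀ × M₁) → Prop
  | ee (u v : M₀) : SRel M₀ M₁ (ι F (u, (0 : M₁)) * ι F (v, (0 : M₁)))
      (-(ι F (v, (0 : M₁)) * ι F (u, (0 : M₁))))
  | eo (u : M₀) (v : M₁) : SRel M₀ M₁ (ι F (u, (0 : M₁)) * ι F ((0 : M₀), v))
      (-(ι F ((0 : M₀), v) * ι F (u, (0 : M₁))))
  | oo (u v : M₁) : SRel M₀ M₁ (ι F ((0 : M₀), u) * ι F ((0 : M₀), v))
      (ι F ((0 : M₀), v) * ι F ((0 : M₀), u))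

variable (M₀ M₁ : Type) [AddCommGroup M₀] [Module F M₀] [AddCommGroup M₁] [Module F M₁]

/-- The super-exterior algebra `Λ̄(M₀ ⊕ M₁)`. -/
abbrev SExt : Type := RingQuot (SRel F M₀ M₁)

/-- The canonical image of an even vector. -/
def genE (u : M₀) : SExt F M₀ M₁ := RingQuot.mkAlgHom F (SRel F M₀ M₁) (ι F (u, (0 : M₁)))

/-- The canonical image of an odd vector. -/
def genO (v : M₁) : SExt F M₀ M₁ := RingQuot.mkAlgHom F (SRel F M₀ M₁) (ι F ((0 : M₀), v))

/-- The monomial associated with a list of (even or odd) vectors. -/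
def mon (l : List (M₀ ⊕ M₁)) : SExt F M₀ M₁ :=
  (l.map (Sum.elim (genE F M₀ M₁) (genO F M₀ M₁))).prod

/-- The `ℤ`-degree-`q` component `Λ̄^q` of the super-exterior algebra. -/
def sdeg (q : ℕ) : Submodule F (SExt F M₀ M₁) :=
  Submodule.span F {x | ∃ l : List (M₀ ⊕ M₁), l.length = q ∧ x = mon F M₀ M₁ l}

/-- The `ℤ₂`-homogeneous component of parity `ε` of the super-exterior algebra. -/
def sparity (ε : Bool) : Submodule F (SExt F M₀ M₁) :=
  Submodule.span F {x | ∃ l : List (M₀ ⊕ M₁),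
    l.countP Sum.isRight % 2 = (if ε then 1 else 0) ∧ x = mon F M₀ M₁ l}

/-- `D` satisfies the Leibniz rule of an exterior superderivation of
`ℤ×ℤ₂`-degree `(1, 0̄)`:  `D(μ∧ν) = Dμ∧ν + (-1)^‖μ‖ μ∧Dν`. -/
def IsLeib (D : SExt F M₀ M₁ →ₗ[F] SExt F M₀ M₁) : Prop :=
  ∀ (q : ℕ) (x : SExt F M₀ M₁), x ∈ sdeg F M₀ M₁ q → ∀ y : SExt F M₀ M₁,
    D (x * y) = D x * y + ((-1 : F) ^ q) • (x * D y)

/-- `D` raises the `ℤ`-degree by one. -/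
def RaisesDeg (D : SExt F M₀ M₁ →ₗ[F] SExt F M₀ M₁) : Prop :=
  ∀ (q : ℕ) (x : SExt F M₀ M₁), x ∈ sdeg F M₀ M₁ q → D x ∈ sdeg F M₀ M₁ (q + 1)

/-- `D` has `ℤ₂`-degree `0̄`. -/
def KeepsParity (D : SExt F M₀ M₁ →ₗ[F] SExt F M₀ M₁) : Prop :=
  ∀ (ε : Bool) (x : SExt F M₀ M₁), x ∈ sparity F M₀ M₁ ε → D x ∈ sparity F M₀ M₁ ε

open Module

variable (n : ℕ)

/-- The even part of `𝔥_n`: the span of `x₁,…,x_n`. -/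
abbrev KV₀ : Type := Fin n → F

/-- The odd part of `𝔥_n`: the span of `y₁,…,y_n` and the central `z` (last coordinate). -/
abbrev KV₁ : Type := Fin (n + 1) → F

/-- The bracket of the Heisenberg Lie superalgebra `𝔥_n` with odd center: `[x_i, y_i] = z`. -/
def kBr (a b : KV₀ F n × KV₁ F n) : KV₀ F n × KV₁ F n :=
  (0, Pi.single (Fin.last n)
    (∑ i : Fin n, (a.1 i * b.2 i.castSucc - b.1 i * a.2 i.castSucc)))

/-- The cochain algebra `Λ̄ 𝔥_n*`. -/
abbrev KC : Type := SExt F (Dual F (KV₀ F n)) (Dual F (KV₁ F n))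

/-- The dual basis vector `e_i` (even). -/
def kE (i : Fin n) : KC F n :=
  genE F (Dual F (KV₀ F n)) (Dual F (KV₁ F n)) (LinearMap.proj i)

/-- The dual basis vector `o_j` (odd). -/
def kO (j : Fin n) : KC F n :=
  genO F (Dual F (KV₀ F n)) (Dual F (KV₁ F n)) (LinearMap.proj j.castSucc)

/-- The dual `z*` of the odd center (odd). -/
def kZ : KC F n :=
  genO F (Dual F (KV₀ F n)) (Dual F (KV₁ F n)) (LinearMap.proj (Fin.last n))

/-- `τ_{(n,1)} = ∑ o_i ∧ e_i`. -/
def kTau : KC F n := ∑ i : Fin n, kO F n i * kE F n i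

/-- `τ_{(n,l)} = l τ_{(n,1)} ∧ (z*)^{l−1}`. -/
def kTauL (l : ℕ) : KC F n := (l : F) • (kTau F n * kZ F n ^ (l - 1))

/-- `H_n^q`: the degree-`q` part of `Λ̄ V` for `V` the span of `e₁,…,e_n, o₁,…,o_n`
(the dual vectors other than `z*`, i.e. odd functionals vanishing on `z`). -/
def Hn (q : ℕ) : Submodule F (KC F n) :=
  Submodule.span F {x | ∃ l : List (Dual F (KV₀ F n) ⊕ Dual F (KV₁ F n)),
    l.length = q ∧
    (∀ h : Dual F (KV₁ F n), Sum.inr h ∈ l → h (Pi.single (Fin.last n) 1) = 0) ∧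
    x = mon F (Dual F (KV₀ F n)) (Dual F (KV₁ F n)) l}

/-- The top exterior monomial `e₁ ∧ ⋯ ∧ e_n`. -/
def kTop : KC F n :=
  mon F (Dual F (KV₀ F n)) (Dual F (KV₁ F n))
    (List.ofFn fun i : Fin n => Sum.inl (LinearMap.proj i))

/-- `D` is the differential of the cochain complex of `𝔥_n`: the degree-one superderivation
with `D e_i = 0`, `D o_j = 0` and `D z* = τ_{(n,1)} = ∑ o_i ∧ e_i` (equivalently,
`D h = h(z) • τ` for every odd functional `h`). -/
def IsDiffN (D : KC F n →ₗ[F] KC F n) : Prop :=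
  RaisesDeg F (Dual F (KV₀ F n)) (Dual F (KV₁ F n)) D ∧
  IsLeib F (Dual F (KV₀ F n)) (Dual F (KV₁ F n)) D ∧
  (∀ f : Dual F (KV₀ F n), D (genE F (Dual F (KV₀ F n)) (Dual F (KV₁ F n)) f) = 0) ∧
  (∀ h : Dual F (KV₁ F n),
    D (genO F (Dual F (KV₀ F n)) (Dual F (KV₁ F n)) h) =
      h (Pi.single (Fin.last n) 1) • kTau F n)

/-- The space of `q`-cocycles of `𝔥_n`. -/
def Zn (D : KC F n →ₗ[F] KC F n) (q : ℕ) : Submodule F (KC F n) :=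
  sdeg F (Dual F (KV₀ F n)) (Dual F (KV₁ F n)) q ⊓ LinearMap.ker D


/-! ### Universal property and induction -/

section Helpers

variable {F M₀ M₁}

theorem genE_add (u v : M₀) : genE F M₀ M₁ (u + v) = genE F M₀ M₁ u + genE F M₀ M₁ v := by
  unfold genE
  rw [← map_add, ← map_add]
  simp

theorem genE_smul (c : F) (v : M₀) : genE F M₀ M₁ (c • v) = c • genE F M₀ M₁ v := by
  unfold genE
  rw [← map_smul, ← map_smul]
  simp

theorem genO_add (u v : M₁) : genO F M₀ M₁ (u + v) = genO F M₀ M₁ u + genO F M₀ M₁ v := by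
  unfold genO
  rw [← map_add, ← map_add]
  simp

theorem genO_smul (c : F) (v : M₁) : genO F M₀ M₁ (c • v) = c • genO F M₀ M₁ v := by
  unfold genO
  rw [← map_smul, ← map_smul]
  simp

/-- `genE` as a linear map. -/
def linE : M₀ →ₗ[F] SExt F M₀ M₁ where
  toFun := genE F M₀ M₁
  map_add' := genE_add
  map_smul' := genE_smul

/-- `genO` as a linear map. -/
def linO : M₁ →ₗ[F] SExt F M₀ M₁ where
  toFun := genO F M₀ M₁
  map_add' := genO_add
  map_smul' := genO_smul

@[simp] theorem linE_apply (u : M₀) : (linE u : SExt F M₀ M₁) = genE F M₀ M₁ u := rfl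
@[simp] theorem linO_apply (u : M₁) : (linO u : SExt F M₀ M₁) = genO F M₀ M₁ u := rfl

theorem rel_ee (u v : M₀) :
    genE F M₀ M₁ u * genE F M₀ M₁ v = (-1 : F) • (genE F M₀ M₁ v * genE F M₀ M₁ u) := by
  have := RingQuot.mkAlgHom_rel F (SRel.ee (F := F) (M₁ := M₁) u v)
  rw [← neg_one_smul F, map_smul, map_mul, map_mul] at this
  exact this

theorem rel_eo (u : M₀) (v : M₁) :
    genE F M₀ M₁ u * genO F M₀ M₁ v = (-1 : F) • (genO F M₀ M₁ v * genE F M₀ M₁ u) := by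
  have := RingQuot.mkAlgHom_rel F (SRel.eo (F := F) u v)
  rw [← neg_one_smul F, map_smul, map_mul, map_mul] at this
  exact this

theorem rel_oo (u v : M₁) :
    genO F M₀ M₁ u * genO F M₀ M₁ v = genO F M₀ M₁ v * genO F M₀ M₁ u := by
  have := RingQuot.mkAlgHom_rel F (SRel.oo (F := F) (M₀ := M₀) u v)
  simpa [genO] using this

/-- The universal property. -/
theorem exists_lift {B : Type} [Semiring B] [Algebra F B] (f : M₀ →ₗ[F] B) (g : M₁ →ₗ[F] B)
    (hee : ∀ u v, f u * f v = (-1 : F) • (f v * f u)) (heo : ∀ u v, f u * g v = (-1 : F) • (g v * f u))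
    (hoo : ∀ u v, g u * g v = g v * g u) :
    ∃ Φ : SExt F M₀ M₁ →ₐ[F] B, (∀ u, Φ (genE F M₀ M₁ u) = f u) ∧
      (∀ v, Φ (genO F M₀ M₁ v) = g v) := by
  have H : ∀ ⦃x y : TensorAlgebra F (M₀ × M₁)⦄, SRel F M₀ M₁ x y →
      TensorAlgebra.lift F (f.coprod g) x = TensorAlgebra.lift F (f.coprod g) y := by
    intro x y h
    induction h with
    | ee u v => rw [← neg_one_smul F, map_smul]; simpa using hee u v
    | eo u v => rw [← neg_one_smul F, map_smul]; simpa using heo u v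
    | oo u v => simpa using hoo u v
  refine ⟨RingQuot.liftAlgHom F ⟨TensorAlgebra.lift F (f.coprod g), H⟩, ?_, ?_⟩
  · intro u
    simp [genE]
  · intro v
    simp [genO]

theorem sext_induction {p : SExt F M₀ M₁ → Prop} (hs : ∀ c : F, p (algebraMap F _ c))
    (hE : ∀ u, p (genE F M₀ M₁ u)) (hO : ∀ u, p (genO F M₀ M₁ u))
    (hadd : ∀ x y, p x → p y → p (x + y)) (hmul : ∀ x y, p x → p y → p (x * y)) (x) : p x := by
  obtain ⟨y, rfl⟩ := RingQuot.mkAlgHom_surjective F (SRel F M₀ M₁) x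
  induction y using TensorAlgebra.induction with
  | algebraMap r => simpa using hs r
  | ι m =>
    have : (ι F m : TensorAlgebra F (M₀ × M₁)) = ι F (m.1, 0) + ι F (0, m.2) := by
      rw [← map_add]; simp
    rw [this, map_add]
    exact hadd _ _ (hE _) (hO _)
  | mul a b ha hb => rw [map_mul]; exact hmul _ _ ha hb
  | add a b ha hb => rw [map_add]; exact hadd _ _ ha hb

/-- The sign automorphism with `e ↦ -e`, `o ↦ d o`. -/
theorem exists_sgn (d : F) : ∃ s : SExt F M₀ M₁ →ₐ[F] SExt F M₀ M₁,
    (∀ u, s (genE F M₀ M₁ u) = (-1 : F) • genE F M₀ M₁ u) ∧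
      (∀ v, s (genO F M₀ M₁ v) = d • genO F M₀ M₁ v) := by
  refine exists_lift (F := F) (M₀ := M₀) (M₁ := M₁) (B := SExt F M₀ M₁) ((-1 : F) • linE) (d • linO)
    ?_ ?_ ?_
  · intro u v
    simp only [LinearMap.smul_apply, linE_apply, smul_mul_assoc, mul_smul_comm, rel_ee u v]
  · intro u v
    simp only [LinearMap.smul_apply, linE_apply, linO_apply, smul_mul_assoc, mul_smul_comm,
      rel_eo u v, smul_smul]
    congr 1; ring
  · intro u v
    simp only [LinearMap.smul_apply, linO_apply, smul_mul_assoc, mul_smul_comm, rel_oo u v]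

variable (M₀ M₁) in
def sgn (d : F) : SExt F M₀ M₁ →ₐ[F] SExt F M₀ M₁ := (exists_sgn d).choose

@[simp] theorem sgn_E (d : F) (u : M₀) : sgn M₀ M₁ d (genE F M₀ M₁ u) = (-1 : F) • genE F M₀ M₁ u :=
  (exists_sgn d).choose_spec.1 u
@[simp] theorem sgn_O (d : F) (u : M₁) : sgn M₀ M₁ d (genO F M₀ M₁ u) = d • genO F M₀ M₁ u :=
  (exists_sgn d).choose_spec.2 u

/-- Twisted derivations. -/
theorem exists_der (d : F) (φ : M₀ →ₗ[F] F) (ψ : M₁ →ₗ[F] F) (h0 : ∀ u, φ u * (1 + d) = 0)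
    (h1 : ∀ u, ψ u * (1 - d) = 0) : ∃ D : SExt F M₀ M₁ →ₗ[F] SExt F M₀ M₁,
    (∀ u, D (genE F M₀ M₁ u) = φ u • 1) ∧ (∀ u, D (genO F M₀ M₁ u) = ψ u • 1) ∧
    (∀ x y, D (x * y) = x * D y + D x * sgn M₀ M₁ d y) := by
  let f : M₀ →ₗ[F] Matrix (Fin 2) (Fin 2) (SExt F M₀ M₁) :=
    { toFun := fun u => !![genE F M₀ M₁ u, φ u • 1; 0, (-1 : F) • genE F M₀ M₁ u]
      map_add' := by
        intro u v
        ext i j; fin_cases i <;> fin_cases j <;> simp [genE_add, add_smul, -neg_smul]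
      map_smul' := by
        intro u v
        ext i j; fin_cases i <;> fin_cases j <;> simp [genE_smul, mul_smul, smul_comm (-1 : F), -neg_smul] }
  let g : M₁ →ₗ[F] Matrix (Fin 2) (Fin 2) (SExt F M₀ M₁) :=
    { toFun := fun u => !![genO F M₀ M₁ u, ψ u • 1; 0, d • genO F M₀ M₁ u]
      map_add' := by
        intro u v
        ext i j; fin_cases i <;> fin_cases j <;> simp [genO_add, add_smul]
      map_smul' := by
        intro u v
        ext i j; fin_cases i <;> fin_cases j <;> simp [genO_smul, mul_smul, smul_comm d] }
  have hf : ∀ u, f u = !![genE F M₀ M₁ u, φ u • 1; 0, (-1 : F) • genE F M₀ M₁ u] := fun _ => rfl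
  have hg : ∀ u, g u = !![genO F M₀ M₁ u, ψ u • 1; 0, d • genO F M₀ M₁ u] := fun _ => rfl
  obtain ⟨Φ, hE, hO⟩ := exists_lift (F := F) f g
    (by
      intro u v
      rw [hf, hf, Matrix.mul_fin_two, Matrix.mul_fin_two]
      ext i j; fin_cases i <;> fin_cases j
      · simpa using rel_ee u v
      · simp [smul_smul, add_comm, -neg_smul]
      · simp
      · simp [rel_ee u v, -neg_smul])
    (by
      intro u v
      rw [hf, hg, Matrix.mul_fin_two, Matrix.mul_fin_two]
      ext i j; fin_cases i <;> fin_cases j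
      · simpa [-neg_smul] using rel_eo u v
      · have h2 : d * φ u = -1 * φ u := by linear_combination h0 u
        simp [smul_smul, h2, -neg_smul, add_comm]
      · simp
      · simp [rel_eo u v, smul_smul, -neg_smul])
    (by
      intro u v
      rw [hg, hg, Matrix.mul_fin_two, Matrix.mul_fin_two]
      ext i j; fin_cases i <;> fin_cases j
      · simpa using rel_oo u v
      · have h2 : d * ψ u = ψ u := by linear_combination - h1 u
        have h3 : d * ψ v = ψ v := by linear_combination - h1 v
        simp [smul_smul, h2, h3, add_comm]
      · simp
      · simp [rel_oo u v])
  have key : ∀ x, Φ x 0 0 = x ∧ Φ x 1 0 = 0 ∧ Φ x 1 1 = sgn M₀ M₁ d x := by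
    intro x
    induction x using sext_induction with
    | hs c => simp [Matrix.algebraMap_matrix_apply]
    | hE u => simp [hE, hf]
    | hO u => simp [hO, hg]
    | hadd x y hx hy => simp [hx, hy]
    | hmul x y hx hy => simp [Matrix.mul_apply, Fin.sum_univ_two, hx, hy]
  refine ⟨(Matrix.entryLinearMap F _ 0 1).comp Φ.toLinearMap, ?_, ?_, ?_⟩
  · intro u; simp [hE, hf]
  · intro u; simp [hO, hg]
  · intro x y; simp [Matrix.mul_apply, Fin.sum_univ_two, key]

theorem sgn_comm_E (u : M₀) (y : SExt F M₀ M₁) :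
    sgn M₀ M₁ (-1) y * genE F M₀ M₁ u = genE F M₀ M₁ u * y := by
  induction y using sext_induction with
  | hs c => simp [Algebra.commutes]
  | hE v => simp [rel_ee u v, -neg_smul]
  | hO v => simp [rel_eo u v, -neg_smul]
  | hadd x y hx hy => simp [add_mul, mul_add, hx, hy]
  | hmul x y hx hy => rw [map_mul, mul_assoc, hy, ← mul_assoc, hx, mul_assoc]

theorem sgn_comm_O (u : M₁) (y : SExt F M₀ M₁) :
    sgn M₀ M₁ 1 y * genO F M₀ M₁ u = genO F M₀ M₁ u * y := by
  induction y using sext_induction with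
  | hs c => simp [Algebra.commutes]
  | hE v => simp [rel_eo v u, smul_smul, -neg_smul]
  | hO v => simp [rel_oo u v]
  | hadd x y hx hy => simp [add_mul, mul_add, hx, hy]
  | hmul x y hx hy => rw [map_mul, mul_assoc, hy, ← mul_assoc, hx, mul_assoc]

/-- Contraction with respect to an even functional. -/
def conE (φ : M₀ →ₗ[F] F) : SExt F M₀ M₁ →ₗ[F] SExt F M₀ M₁ :=
  (exists_der (-1) φ 0 (by simp) (by simp)).choose

/-- Contraction with respect to an odd functional. -/
def conO (φ : M₁ →ₗ[F] F) : SExt F M₀ M₁ →ₗ[F] SExt F M₀ M₁ :=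
  (exists_der 1 0 φ (by simp) (by simp)).choose

@[simp] theorem conE_E (φ : M₀ →ₗ[F] F) (u : M₀) :
    conE φ (genE F M₀ M₁ u) = φ u • 1 :=
  (exists_der (-1) φ (0 : M₁ →ₗ[F] F) (by simp) (by simp)).choose_spec.1 u

@[simp] theorem conE_O (φ : M₀ →ₗ[F] F) (u : M₁) :
    conE φ (genO F M₀ M₁ u) = 0 := by
  rw [← zero_smul F (1 : SExt F M₀ M₁)]
  exact (exists_der (-1) φ (0 : M₁ →ₗ[F] F) (by simp) (by simp)).choose_spec.2.1 u

theorem conE_mul (φ : M₀ →ₗ[F] F) (x y : SExt F M₀ M₁) :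
    conE φ (x * y) = x * conE φ y + conE φ x * sgn M₀ M₁ (-1) y :=
  (exists_der (-1) φ (0 : M₁ →ₗ[F] F) (by simp) (by simp)).choose_spec.2.2 x y

@[simp] theorem conO_E (φ : M₁ →ₗ[F] F) (u : M₀) :
    conO φ (genE F M₀ M₁ u) = 0 := by
  rw [← zero_smul F (1 : SExt F M₀ M₁)]
  exact (exists_der 1 (0 : M₀ →ₗ[F] F) φ (by simp) (by simp)).choose_spec.1 u

@[simp] theorem conO_O (φ : M₁ →ₗ[F] F) (u : M₁) :
    conO φ (genO F M₀ M₁ u) = φ u • 1 :=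
  (exists_der 1 (0 : M₀ →ₗ[F] F) φ (by simp) (by simp)).choose_spec.2.1 u

theorem conO_mul (φ : M₁ →ₗ[F] F) (x y : SExt F M₀ M₁) :
    conO φ (x * y) = x * conO φ y + conO φ x * sgn M₀ M₁ 1 y :=
  (exists_der 1 (0 : M₀ →ₗ[F] F) φ (by simp) (by simp)).choose_spec.2.2 x y

@[simp] theorem conE_one (φ : M₀ →ₗ[F] F) : conE φ (1 : SExt F M₀ M₁) = 0 := by
  have := conE_mul φ (1 : SExt F M₀ M₁) 1
  simpa using this

@[simp] theorem conO_one (φ : M₁ →ₗ[F] F) : conO φ (1 : SExt F M₀ M₁) = 0 := by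
  have := conO_mul φ (1 : SExt F M₀ M₁) 1
  simpa using this

@[simp] theorem mon_nil : mon F M₀ M₁ [] = 1 := rfl
@[simp] theorem mon_inl (u : M₀) (l) :
    mon F M₀ M₁ (Sum.inl u :: l) = genE F M₀ M₁ u * mon F M₀ M₁ l := by simp [mon]
@[simp] theorem mon_inr (u : M₁) (l) :
    mon F M₀ M₁ (Sum.inr u :: l) = genO F M₀ M₁ u * mon F M₀ M₁ l := by simp [mon]
theorem mon_append (l l₂) :
    mon F M₀ M₁ (l ++ l₂) = mon F M₀ M₁ l * mon F M₀ M₁ l₂ := by simp [mon]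

/-- Sorting. -/
theorem mon_sort (l : List (M₀ ⊕ M₁)) : ∃ (c : F) (l0 : List M₀) (l1 : List (M₀ ⊕ M₁)),
    l0.length = l.countP Sum.isLeft ∧
    mon F M₀ M₁ l = c • (mon F M₀ M₁ (l0.map Sum.inl) * mon F M₀ M₁ l1) := by
  induction l with
  | nil => exact ⟨1, [], [], rfl, by simp⟩
  | cons a l ih =>
    obtain ⟨c, l0, l1, h, h'⟩ := ih
    cases a with
    | inl u => exact ⟨c, u :: l0, l1, by simp [h, List.countP_cons], by simp [h', mul_assoc]⟩
    | inr u =>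
      have : ∀ l0 : List M₀, ∃ c : F, genO F M₀ M₁ u * mon F M₀ M₁ (l0.map Sum.inl) =
          c • (mon F M₀ M₁ (l0.map Sum.inl) * genO F M₀ M₁ u) := by
        intro l0
        induction l0 with
        | nil => exact ⟨1, by simp⟩
        | cons v l0 ih =>
          obtain ⟨c, hc⟩ := ih
          refine ⟨-1 * c, ?_⟩
          have h2 : genO F M₀ M₁ u * genE F M₀ M₁ v =
              (-1 : F) • (genE F M₀ M₁ v * genO F M₀ M₁ u) := by
            rw [rel_eo, smul_smul]; simp
          rw [List.map_cons, mon_inl, ← mul_assoc, h2, smul_mul_assoc, mul_assoc, hc, mul_smul_comm,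
            smul_smul, mul_assoc]
      obtain ⟨c', hc'⟩ := this l0
      refine ⟨c * c', l0, Sum.inr u :: l1, by simp [h], ?_⟩
      rw [mon_inr, h', mul_smul_comm, ← mul_assoc, hc', mon_inr, smul_mul_assoc, smul_smul,
        mul_assoc]

variable (M₁) in
theorem exists_extHom [CharZero F] : ∃ j : ExteriorAlgebra F M₀ →ₐ[F] SExt F M₀ M₁,
    ∀ (k : ℕ) (v : Fin k → M₀), j (ExteriorAlgebra.ιMulti F k v) =
      mon F M₀ M₁ (List.ofFn fun i => Sum.inl (v i)) := by
  have hsq : ∀ m : M₀, (linE m : SExt F M₀ M₁) * linE m = 0 := by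
    intro m
    have h := rel_ee (F := F) (M₁ := M₁) m m
    have h2 : (2 : F) • (genE F M₀ M₁ m * genE F M₀ M₁ m) = 0 := by
      
      rw [two_smul]
      nth_rewrite 2 [h]
      nth_rewrite 1 [← one_smul F (genE F M₀ M₁ m * genE F M₀ M₁ m)]
      rw [← add_smul]; simp
    exact (smul_eq_zero.mp h2).resolve_left two_ne_zero
  refine ⟨ExteriorAlgebra.lift F ⟨linE, hsq⟩, ?_⟩
  intro k v
  rw [ExteriorAlgebra.ιMulti_apply, map_list_prod, mon, List.map_ofFn, List.map_ofFn]
  congr 2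
  funext i
  simp

variable (M₀ M₁) in
theorem exists_projHom : ∃ j : SExt F M₀ M₁ →ₐ[F] ExteriorAlgebra F M₀,
    (∀ v, j (genO F M₀ M₁ v) = 0) ∧ ∀ (k : ℕ) (v : Fin k → M₀),
    j (mon F M₀ M₁ (List.ofFn fun i => Sum.inl (v i))) = (ExteriorAlgebra.ιMulti F k v) := by
  obtain ⟨j, h1, h2⟩ := exists_lift (F := F) (M₁ := M₁) (ExteriorAlgebra.ι F (M := M₀)) 0
    (fun u v => by
      rw [neg_one_smul, eq_neg_iff_add_eq_zero]; exact ExteriorAlgebra.ι_add_mul_swap u v) (by simp) (by simp)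
  refine ⟨j, fun v => by simp [h2], ?_⟩
  intro k v
  rw [ExteriorAlgebra.ιMulti_apply, mon, map_list_prod, List.map_ofFn, List.map_ofFn]
  congr 2
  funext i
  simp [h1]

theorem ιMulti_eq_det {k : ℕ} (b : Basis (Fin k) F M₀) (v : Fin k → M₀) :
    ExteriorAlgebra.ιMulti F k v = b.det v • ExteriorAlgebra.ιMulti F k b := by
  have : ExteriorAlgebra.ιMulti F k =
      (LinearMap.toSpanSingleton F _ (ExteriorAlgebra.ιMulti F k b)).compAlternatingMap b.det := by
    refine Basis.ext_alternating b fun i h => ?_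
    let σ : Equiv.Perm (Fin k) := Equiv.ofBijective i (Finite.injective_iff_bijective.1 h)
    change ExteriorAlgebra.ιMulti F k (b ∘ σ) = b.det (b ∘ σ) • _
    rw [AlternatingMap.map_perm, AlternatingMap.map_perm, Basis.det_self]
    simp
  conv_lhs => rw [this]
  simp

theorem ιMulti_ne_zero {k : ℕ} (b : Basis (Fin k) F M₀) :
    ExteriorAlgebra.ιMulti F k b ≠ 0 := by
  classical
  intro h
  let f : ∀ i, M₀ [⋀^Fin i]→ₗ[F] F := fun i => if h : i = k then by subst h; exact b.det else 0
  have := ExteriorAlgebra.liftAlternating_apply_ιMulti f b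
  rw [h] at this
  simp [f, Basis.det_self] at this

end Helpers

section Main

theorem eig_aux {F M : Type} [Field F] [CharZero F] [AddCommGroup M] [Module F M]
    (f : M →ₗ[F] M) (s : Finset ℕ) : ∀ (x : ℕ → M) (_ : ∀ a ∈ s, f (x a) = ((a : F) + 1) • x a)
    (_ : ∑ a ∈ s, x a = 0), ∀ a ∈ s, x a = 0 := by
  classical
  induction s using Finset.induction_on with
  | empty => simp
  | insert b s hb ih =>
    intro x hx h0
    have h1 : ∑ a ∈ s, ((a : F) - b) • x a = 0 := by
      have h2 := congrArg f h0
      rw [map_sum, Finset.sum_congr rfl hx, map_zero, Finset.sum_insert hb] at h2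
      rw [Finset.sum_insert hb] at h0
      have h3 : ∑ a ∈ s, ((a : F) - b) • x a =
          ∑ a ∈ s, ((a : F) + 1) • x a - ((b : F) + 1) • ∑ a ∈ s, x a := by
        rw [Finset.smul_sum, ← Finset.sum_sub_distrib]
        refine Finset.sum_congr rfl fun a _ => ?_
        rw [← sub_smul]; congr 1; ring
      have h4 : ∑ a ∈ s, x a = - x b := by rw [eq_neg_iff_add_eq_zero, add_comm, h0]
      rw [h3, h4, smul_neg, sub_neg_eq_add, add_comm, h2]
    have h5 := ih (fun a => ((a : F) - b) • x a) (fun a ha => by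
      rw [map_smul, hx a (Finset.mem_insert_of_mem ha), smul_comm]) h1
    have h6 : ∀ a ∈ s, x a = 0 := by
      intro a ha
      refine (smul_eq_zero.mp (h5 a ha)).resolve_left ?_
      intro h
      rw [sub_eq_zero] at h
      exact hb (Nat.cast_injective h ▸ ha)
    intro a ha
    rcases Finset.mem_insert.mp ha with rfl | ha
    · rw [Finset.sum_insert hb, Finset.sum_eq_zero h6, add_zero] at h0
      exact h0
    · exact h6 a ha

theorem eig_aux' {F M : Type} [Field F] [CharZero F] [AddCommMonoid M] [Module F M]
    (f : M →ₗ[F] M) (s : Finset ℕ) (x : ℕ → M) (hx : ∀ a ∈ s, f (x a) = ((a : F) + 1) • x a)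
    (h0 : ∑ a ∈ s, x a = 0) : ∀ a ∈ s, x a = 0 := by
  let _ : AddCommGroup M := Module.addCommMonoidToAddCommGroup F
  exact eig_aux f s x hx h0

variable {F n}

/-- Contractions. -/
def cE (j : Fin n) : KC F n →ₗ[F] KC F n := conE (Dual.eval F (KV₀ F n) (Pi.single j 1))
def cO (j : Fin (n + 1)) : KC F n →ₗ[F] KC F n := conO (Dual.eval F (KV₁ F n) (Pi.single j 1))

/-- Number operators. -/
def nE : KC F n →ₗ[F] KC F n := ∑ j, (LinearMap.mulRight F (kE F n j)).comp (cE j)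
def nO : KC F n →ₗ[F] KC F n :=
  ∑ j : Fin n, (LinearMap.mulRight F (kO F n j)).comp (cO j.castSucc)
def nZ : KC F n →ₗ[F] KC F n := (LinearMap.mulRight F (kZ F n)).comp (cO (Fin.last n))

theorem nE_apply (x : KC F n) : nE x = ∑ j, cE j x * kE F n j := by simp [nE]
theorem nO_apply (x : KC F n) : nO x = ∑ j : Fin n, cO j.castSucc x * kO F n j := by simp [nO]
theorem nZ_apply (x : KC F n) : nZ x = cO (Fin.last n) x * kZ F n := by simp [nZ]

theorem nE_mul (x y : KC F n) : nE (x * y) = x * nE y + nE x * y := by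
  simp only [nE_apply, Finset.mul_sum, Finset.sum_mul, ← Finset.sum_add_distrib]
  refine Finset.sum_congr rfl fun j _ => ?_
  rw [cE, conE_mul, add_mul, mul_assoc, mul_assoc, kE, sgn_comm_E, mul_assoc]

theorem nO_mul (x y : KC F n) : nO (x * y) = x * nO y + nO x * y := by
  simp only [nO_apply, Finset.mul_sum, Finset.sum_mul, ← Finset.sum_add_distrib]
  refine Finset.sum_congr rfl fun j _ => ?_
  rw [cO, conO_mul, add_mul, mul_assoc, mul_assoc, kO, sgn_comm_O, mul_assoc]

theorem nZ_mul (x y : KC F n) : nZ (x * y) = x * nZ y + nZ x * y := by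
  simp only [nZ_apply]
  rw [cO, conO_mul, add_mul, mul_assoc, mul_assoc, kZ, sgn_comm_O, mul_assoc]

abbrev gE (u : Dual F (KV₀ F n)) : KC F n := genE F (Dual F (KV₀ F n)) (Dual F (KV₁ F n)) u
abbrev gO (u : Dual F (KV₁ F n)) : KC F n := genO F (Dual F (KV₀ F n)) (Dual F (KV₁ F n)) u
abbrev mn (l : List (Dual F (KV₀ F n) ⊕ Dual F (KV₁ F n))) : KC F n :=
  mon F (Dual F (KV₀ F n)) (Dual F (KV₁ F n)) l

theorem dual_expand {k : ℕ} (u : Dual F (Fin k → F)) :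
    u = ∑ j, u (Pi.single j 1) • (LinearMap.proj j : Dual F (Fin k → F)) := by
  refine LinearMap.pi_ext' fun i => LinearMap.ext_ring ?_
  simp [Pi.single_apply]

theorem nE_E (u : Dual F (KV₀ F n)) : nE (gE u) = gE u := by
  conv_rhs => rw [gE, dual_expand u, ← linE_apply, map_sum]
  rw [nE_apply]
  refine Finset.sum_congr rfl fun j _ => ?_
  simp [cE, kE]

theorem nE_O (u : Dual F (KV₁ F n)) : nE (gO u) = 0 := by
  simp [nE_apply, cE]

theorem nO_E (u : Dual F (KV₀ F n)) : nO (gE u) = 0 := by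
  simp [nO_apply, cO]

theorem nZ_E (u : Dual F (KV₀ F n)) : nZ (gE u) = 0 := by
  simp [nZ_apply, cO]

theorem nOZ_O (u : Dual F (KV₁ F n)) : nO (gO u) + nZ (gO u) = gO u := by
  conv_rhs => rw [gO, dual_expand u, ← linO_apply, map_sum, Fin.sum_univ_castSucc]
  rw [nO_apply, nZ_apply]
  congr 1
  · refine Finset.sum_congr rfl fun j _ => ?_
    simp [cO, kO]
  · simp [cO, kZ]

theorem nZ_O (u : Dual F (KV₁ F n)) (hu : u (Pi.single (Fin.last n) 1) = 0) : nZ (gO u) = 0 := by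
  simp [nZ_apply, cO, hu]

theorem nO_O (u : Dual F (KV₁ F n)) (hu : u (Pi.single (Fin.last n) 1) = 0) :
    nO (gO u) = gO u := by
  have := nOZ_O u
  rwa [nZ_O u hu, add_zero] at this

theorem nE_one : nE (1 : KC F n) = 0 := by simp [nE_apply, cE]
theorem nO_one : nO (1 : KC F n) = 0 := by simp [nO_apply, cO]
theorem nZ_one : nZ (1 : KC F n) = 0 := by simp [nZ_apply, cO]

theorem nE_mon (l : List (Dual F (KV₀ F n) ⊕ Dual F (KV₁ F n))) :
    nE (mn l) = (l.countP Sum.isLeft : F) • mn l := by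
  induction l with
  | nil => simp [mn, nE_one]
  | cons a l ih =>
    rcases a with u | u
    · rw [mn, mon_inl, nE_mul, nE_E, ih, List.countP_cons]
      simp [add_smul]
    · rw [mn, mon_inr, nE_mul, nE_O, ih, List.countP_cons]
      simp

theorem nT_mon (l : List (Dual F (KV₀ F n) ⊕ Dual F (KV₁ F n))) :
    (nE + nO + nZ : KC F n →ₗ[F] KC F n) (mn l) = (l.length : F) • mn l := by
  induction l with
  | nil => simp [mn, nE_one, nO_one, nZ_one]
  | cons a l ih =>
    simp only [LinearMap.add_apply] at ih ⊢
    rcases a with u | u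
    · rw [mn, mon_inl, nE_mul, nE_E, nO_mul, nZ_mul, nO_E, nZ_E, List.length_cons, Nat.cast_add,
        add_smul, ← mul_smul_comm, ← ih]
      simp only [mul_add, zero_mul, add_zero, Nat.cast_one, one_smul]
      abel
    · rw [mn, mon_inr, nE_mul, nE_O, nO_mul, nZ_mul, List.length_cons, Nat.cast_add,
        add_smul, ← mul_smul_comm, ← ih, Nat.cast_one, one_smul]
      have h6 : gO u * mn l = nO (gO u) * mn l + nZ (gO u) * mn l := by
        rw [← add_mul, nOZ_O]
      change _ = gO u * (nE (mn l) + nO (mn l) + nZ (mn l)) + gO u * mn l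
      rw [h6]
      simp only [mul_add, zero_mul, add_zero]
      abel

theorem nO_mon (l : List (Dual F (KV₀ F n) ⊕ Dual F (KV₁ F n)))
    (hl : ∀ h : Dual F (KV₁ F n), Sum.inr h ∈ l → h (Pi.single (Fin.last n) 1) = 0) :
    nO (mn l) = (l.countP Sum.isRight : F) • mn l := by
  induction l with
  | nil => simp [mn, nO_one]
  | cons a l ih =>
    have ih := ih fun h hh => hl h (List.mem_cons_of_mem _ hh)
    rcases a with u | u
    · rw [mn, mon_inl, nO_mul, nO_E, ih, List.countP_cons]
      simp
    · rw [mn, mon_inr, nO_mul, nO_O u (hl u (by simp)), ih, List.countP_cons]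
      simp [add_smul]

theorem nE_tau : nE (kTau F n) = kTau F n := by
  rw [kTau, map_sum]
  refine Finset.sum_congr rfl fun j _ => ?_
  rw [nE_mul, kO, kE, nE_O, nE_E, zero_mul, add_zero]

theorem sgn1_tau : sgn _ _ 1 (kTau F n) = (-1 : F) • kTau F n := by
  rw [kTau, map_sum, Finset.smul_sum]
  refine Finset.sum_congr rfl fun j _ => ?_
  rw [map_mul, kO, kE, sgn_O, sgn_E, one_smul, mul_smul_comm]

theorem sgnm_tau : sgn _ _ (-1) (kTau F n) = kTau F n := by
  rw [kTau, map_sum]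
  refine Finset.sum_congr rfl fun j _ => ?_
  rw [map_mul, kO, kE, sgn_O, sgn_E, mul_smul_comm, smul_mul_assoc, smul_smul]
  simp

theorem cE_tau (j : Fin n) : cE j (kTau F n) = kO F n j := by
  rw [kTau, map_sum, Finset.sum_eq_single j]
  · simp [cE, kO, kE, conE_mul]
  · intro b _ hb
    simp [cE, kO, kE, conE_mul, hb]
  · simp

theorem cO_tau (j : Fin n) : cO j.castSucc (kTau F n) = (-1 : F) • kE F n j := by
  rw [kTau, map_sum, Finset.sum_eq_single j]
  · simp [cO, kO, kE, conO_mul, -neg_smul]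
  · intro b _ hb
    simp [cO, kO, kE, conO_mul, hb]
  · simp

/-- The homotopy. -/
def hop : KC F n →ₗ[F] KC F n := ∑ j : Fin n, (cO j.castSucc).comp (cE j)

theorem hop_tau (x : KC F n) :
    hop (x * kTau F n) + hop x * kTau F n + nE x = (n : F) • x + nO x := by
  have h1 : ∀ j : Fin n, cO j.castSucc (cE j (x * kTau F n)) + cO j.castSucc (cE j x) * kTau F n
      + cE j x * kE F n j = x + cO j.castSucc x * kO F n j := by
    intro j
    have e1 : cE j (x * kTau F n) = x * kO F n j + cE j x * kTau F n := by
      rw [← cE_tau, cE, conE_mul, sgnm_tau]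
    have e2 : cO j.castSucc (x * kO F n j) = x + cO j.castSucc x * kO F n j := by
      simp [cO, conO_mul, kO]
    have e3 : cO j.castSucc (cE j x * kTau F n) =
        (-1 : F) • (cE j x * kE F n j) + (-1 : F) • (cO j.castSucc (cE j x) * kTau F n) := by
      rw [← mul_smul_comm, ← mul_smul_comm, ← cO_tau, ← sgn1_tau]
      exact conO_mul _ _ _
    have e4 : ∀ y : KC F n, (-1 : F) • y + y = 0 := by
      intro y
      nth_rewrite 2 [← one_smul F y]
      rw [← add_smul]; simp
    rw [e1, map_add, e2, e3]
    generalize cO j.castSucc (cE j x) * kTau F n = A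
    generalize cE j x * kE F n j = B
    generalize x + cO j.castSucc x * kO F n j = C
    calc C + ((-1 : F) • B + (-1 : F) • A) + A + B
        = C + (((-1 : F) • B + B) + ((-1 : F) • A + A)) := by abel
      _ = C := by rw [e4, e4]; simp
  have h2 := Finset.sum_congr (s₁ := Finset.univ) rfl fun j _ => h1 j
  simp only [Finset.sum_add_distrib, ← Finset.sum_mul] at h2
  rw [nE_apply, nO_apply]
  simpa [hop, ← Nat.cast_smul_eq_nsmul F] using h2

theorem tau_sq [CharZero F] : kTau F n * kTau F n = 0 := by
  have e4 : ∀ y : KC F n, y = (-1 : F) • y → y = 0 := by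
    intro y hy
    have h2 : (2 : F) • y = 0 := by
      rw [two_smul]
      nth_rewrite 2 [hy]
      nth_rewrite 1 [← one_smul F y]
      rw [← add_smul]; simp
    exact (smul_eq_zero.mp h2).resolve_left two_ne_zero
  apply e4
  simp only [kTau, Finset.sum_mul, Finset.mul_sum, Finset.smul_sum]
  rw [Finset.sum_comm]
  refine Finset.sum_congr rfl fun j _ => Finset.sum_congr rfl fun i _ => ?_
  have q : ∀ i j : Fin n, kO F n i * kE F n i * (kO F n j * kE F n j) =
      (-1 : F) • (kO F n i * kO F n j * (kE F n i * kE F n j)) := by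
    intro i j
    rw [mul_assoc, ← mul_assoc (kE F n i), kE, kO, kO, rel_eo]
    simp only [mul_smul_comm, smul_mul_assoc, mul_assoc]
  rw [q, q]
  congr 1
  simp only [kO, kE]
  rw [rel_oo (LinearMap.proj j.castSucc), rel_ee (LinearMap.proj j), mul_smul_comm]

theorem gE_mul_mem {t : ℕ} (u : Dual F (KV₀ F n)) {x : KC F n} (hx : x ∈ Hn F n t) :
    gE u * x ∈ Hn F n (t + 1) := by
  induction hx using Submodule.span_induction with
  | mem x hx =>
    obtain ⟨l, h1, h2, rfl⟩ := hx
    refine Submodule.subset_span ⟨Sum.inl u :: l, by simp [h1], ?_, by simp⟩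
    intro h hh
    exact h2 h (by simpa using hh)
  | zero => simp
  | add x y _ _ hx hy => rw [mul_add]; exact add_mem hx hy
  | smul c x _ hx => rw [mul_smul_comm]; exact Submodule.smul_mem _ _ hx

theorem gO_mul_mem {t : ℕ} (u : Dual F (KV₁ F n)) (hu : u (Pi.single (Fin.last n) 1) = 0)
    {x : KC F n} (hx : x ∈ Hn F n t) : gO u * x ∈ Hn F n (t + 1) := by
  induction hx using Submodule.span_induction with
  | mem x hx =>
    obtain ⟨l, h1, h2, rfl⟩ := hx
    refine Submodule.subset_span ⟨Sum.inr u :: l, by simp [h1], ?_, by simp⟩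
    intro h hh
    rcases List.mem_cons.mp hh with hh | hh
    · cases hh; exact hu
    · exact h2 h hh
  | zero => simp
  | add x y _ _ hx hy => rw [mul_add]; exact add_mem hx hy
  | smul c x _ hx => rw [mul_smul_comm]; exact Submodule.smul_mem _ _ hx

theorem mem_mul_tau {t : ℕ} {x : KC F n} (hx : x ∈ Hn F n t) : x * kTau F n ∈ Hn F n (t + 2) := by
  induction hx using Submodule.span_induction with
  | mem x hx =>
    obtain ⟨l, h1, h2, rfl⟩ := hx
    rw [kTau, Finset.mul_sum]
    refine Submodule.sum_mem _ fun j _ => ?_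
    refine Submodule.subset_span ⟨l ++ [Sum.inr (LinearMap.proj j.castSucc),
      Sum.inl (LinearMap.proj j)], by simp [h1], ?_, by simp [mon_append, kO, kE]⟩
    intro h hh
    rcases List.mem_append.mp hh with hh | hh
    · exact h2 h hh
    · have : h = LinearMap.proj j.castSucc := by simpa using hh
      subst this
      simp
  | zero => simp
  | add x y _ _ hx hy => rw [add_mul]; exact add_mem hx hy
  | smul c x _ hx => rw [smul_mul_assoc]; exact Submodule.smul_mem _ _ hx

theorem sgn_mon (d : F) (l : List (Dual F (KV₀ F n) ⊕ Dual F (KV₁ F n))) :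
    ∃ c : F, sgn _ _ d (mn l) = c • mn l := by
  induction l with
  | nil => exact ⟨1, by simp [mn]⟩
  | cons a l ih =>
    obtain ⟨c, hc⟩ := ih
    rcases a with u | u
    · refine ⟨-1 * c, ?_⟩
      rw [mn, mon_inl, map_mul, hc, sgn_E, smul_mul_assoc, mul_smul_comm, smul_smul]
    · refine ⟨d * c, ?_⟩
      rw [mn, mon_inr, map_mul, hc, sgn_O, smul_mul_assoc, mul_smul_comm, smul_smul]

theorem der_mem (d : F) (D : KC F n →ₗ[F] KC F n) (hE : ∀ u, ∃ c : F, D (gE u) = c • 1)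
    (hO : ∀ u, ∃ c : F, D (gO u) = c • 1)
    (hD : ∀ x y, D (x * y) = x * D y + D x * sgn _ _ d y) (h1 : D 1 = 0)
    {t : ℕ} {x : KC F n} (hx : x ∈ Hn F n t) : D x ∈ Hn F n (t - 1) := by
  induction hx using Submodule.span_induction with
  | mem x hx =>
    obtain ⟨l, hl, h2, rfl⟩ := hx
    induction l generalizing t with
    | nil => simp [h1]
    | cons a l ih =>
      have h2' := fun h hh => h2 h (List.mem_cons_of_mem a hh)
      have ih := ih rfl h2'
      obtain ⟨c, hc⟩ := sgn_mon d l
      have hm : mn l ∈ Hn F n (t - 1) :=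
        Submodule.subset_span ⟨l, by simp [← hl], h2', rfl⟩
      have ht : t - 1 = l.length := by simp [← hl]
      rcases a with u | u
      · obtain ⟨e, he⟩ := hE u
        rw [mon_inl, hD, he, hc]
        refine add_mem ?_ ?_
        · rw [ht]
          rcases l with _ | ⟨b, l⟩
          · simp [h1]
          · exact gE_mul_mem u ih
        · rw [smul_mul_assoc, one_mul]
          exact Submodule.smul_mem _ _ (Submodule.smul_mem _ _ hm)
      · obtain ⟨e, he⟩ := hO u
        rw [mon_inr, hD, he, hc]
        refine add_mem ?_ ?_
        · rw [ht]
          rcases l with _ | ⟨b, l⟩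
          · simp [h1]
          · exact gO_mul_mem u (h2 u (by simp)) ih
        · rw [smul_mul_assoc, one_mul]
          exact Submodule.smul_mem _ _ (Submodule.smul_mem _ _ hm)
  | zero => simp
  | add x y _ _ hx hy => rw [map_add]; exact add_mem hx hy
  | smul c x _ hx => rw [map_smul]; exact Submodule.smul_mem _ _ hx

theorem hop_mem {t : ℕ} {x : KC F n} (hx : x ∈ Hn F n t) : hop x ∈ Hn F n (t - 2) := by
  rw [hop, LinearMap.sum_apply]
  refine Submodule.sum_mem _ fun j _ => ?_
  have h1 : cE j x ∈ Hn F n (t - 1) :=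
    der_mem (-1) (cE j) (fun u => ⟨_, conE_E _ u⟩) (fun u => ⟨0, by simp [cE]⟩)
      (conE_mul _) (conE_one _) hx
  exact der_mem 1 (cO j.castSucc) (fun u => ⟨0, by simp [cO]⟩) (fun u => ⟨_, conO_O _ u⟩)
      (conO_mul _) (conO_one _) h1

theorem Hn_le_sdeg (t : ℕ) :
    Hn F n t ≤ sdeg F (Dual F (KV₀ F n)) (Dual F (KV₁ F n)) t := by
  refine Submodule.span_mono ?_
  rintro x ⟨l, h1, _, h2⟩
  exact ⟨l, h1, h2⟩

theorem sdeg_eig {t : ℕ} {x : KC F n}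
    (hx : x ∈ sdeg F (Dual F (KV₀ F n)) (Dual F (KV₁ F n)) t) :
    (nE + nO + nZ : KC F n →ₗ[F] KC F n) x = (t : F) • x := by
  induction hx using Submodule.span_induction with
  | mem x hx =>
    obtain ⟨l, rfl, rfl⟩ := hx
    exact nT_mon l
  | zero => simp
  | add x y _ _ hx hy => rw [map_add, hx, hy, smul_add]
  | smul c x _ hx => rw [map_smul, hx, smul_comm]

theorem sub_smul_aux {M : Type} [AddCommMonoid M] [Module F M] {a b : F} {x z : M}
    (h : z + a • x = b • x) : (b - a) • x = z := by
  let _ : AddCommGroup M := Module.addCommMonoidToAddCommGroup F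
  rw [sub_smul, ← h, add_sub_cancel_right]

theorem sdeg_disj [CharZero F] {s t : ℕ} (hst : s ≠ t) {x : KC F n}
    (hx : x ∈ sdeg F (Dual F (KV₀ F n)) (Dual F (KV₁ F n)) s)
    (hx' : x ∈ sdeg F (Dual F (KV₀ F n)) (Dual F (KV₁ F n)) t) : x = 0 := by
  have h : (s : F) • x = (t : F) • x := by rw [← sdeg_eig hx, ← sdeg_eig hx']
  have h2 := sub_smul_aux (F := F) (M := KC F n) (a := s) (b := t) (x := x) (z := 0)
    (by rw [zero_add, h])
  refine (smul_eq_zero.mp h2).resolve_left ?_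
  intro h
  rw [sub_eq_zero] at h
  exact hst (Nat.cast_injective h).symm

/-- Coordinate basis of the dual. -/
def dBasis (F : Type) [Field F] (n : ℕ) : Basis (Fin n) F (Dual F (KV₀ F n)) :=
  (Pi.basisFun F (Fin n)).dualBasis

theorem dBasis_apply (i : Fin n) : dBasis F n i = LinearMap.proj i := by
  ext j
  simp [dBasis, Pi.single_apply]

theorem evens_zero [CharZero F] (l : List (Dual F (KV₀ F n))) (hl : n < l.length) :
    mn (l.map Sum.inl) = (0 : KC F n) := by
  obtain ⟨j, hj⟩ := exists_extHom (F := F) (M₀ := Dual F (KV₀ F n)) (Dual F (KV₁ F n))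
  have h1 := hj l.length l.get
  have h2 : (List.ofFn fun i => (Sum.inl (l.get i) : Dual F (KV₀ F n) ⊕ Dual F (KV₁ F n))) =
      l.map Sum.inl := by
    conv_rhs => rw [← List.ofFn_get l, List.map_ofFn]
    rfl
  rw [h2] at h1
  rw [mn, ← h1, AlternatingMap.map_linearDependent, map_zero]
  intro hli
  have := hli.fintype_card_le_finrank
  simp at this
  omega

theorem evens_top [CharZero F] (l : List (Dual F (KV₀ F n))) (hl : l.length = n) :
    mn (l.map Sum.inl) ∈ Submodule.span F {kTop F n} := by
  obtain ⟨j, hj⟩ := exists_extHom (F := F) (M₀ := Dual F (KV₀ F n)) (Dual F (KV₁ F n))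
  let v : Fin n → Dual F (KV₀ F n) := fun i => l.get (i.cast hl.symm)
  have h2 : (List.ofFn fun i => (Sum.inl (v i) : Dual F (KV₀ F n) ⊕ Dual F (KV₁ F n))) =
      l.map Sum.inl := by
    apply List.ext_get
    · simp [hl]
    · intro k h1 h2
      simp [v]
  have h1 := hj n v
  have h3 := hj n (dBasis F n)
  rw [ιMulti_eq_det (dBasis F n), map_smul, h2, h3] at h1
  rw [mn, ← h1]
  refine Submodule.smul_mem _ _ (Submodule.subset_span ?_)
  simp [kTop, dBasis_apply]

theorem kTop_eq : kTop F n = mn ((List.ofFn fun i : Fin n =>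
    (LinearMap.proj i : Dual F (KV₀ F n))).map Sum.inl) := by
  rw [List.map_ofFn]; rfl

theorem kTop_mem : kTop F n ∈ Hn F n n := by
  refine Submodule.subset_span ⟨_, by simp, ?_, rfl⟩
  intro h hh
  simp at hh

theorem kTop_tau [CharZero F] : kTop F n * kTau F n = 0 := by
  rw [kTau, Finset.mul_sum]
  refine Finset.sum_eq_zero fun j _ => ?_
  have h1 : kO F n j * kE F n j = (-1 : F) • (kE F n j * kO F n j) := by
    rw [kE, kO, rel_eo, smul_smul]; simp
  have h2 : kTop F n * kE F n j = 0 := by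
    have := evens_zero (F := F) ((List.ofFn fun i : Fin n =>
      (LinearMap.proj i : Dual F (KV₀ F n))) ++ [LinearMap.proj j]) (by simp)
    rw [List.map_append, mn, mon_append] at this
    rw [kTop_eq, ← this]
    simp [kE]
  rw [h1, mul_smul_comm, ← mul_assoc, h2, zero_mul, smul_zero]

theorem kTop_not (β : KC F n) : β * kTau F n ≠ kTop F n := by
  intro h
  obtain ⟨j, hj, hj'⟩ := exists_projHom (F := F) (Dual F (KV₀ F n)) (Dual F (KV₁ F n))
  have h1 := congrArg j h
  have h2 : j (kTau F n) = 0 := by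
    rw [kTau, map_sum]
    refine Finset.sum_eq_zero fun i _ => ?_
    rw [map_mul, kO, hj, zero_mul]
  have h3 := hj' n (dBasis F n)
  rw [map_mul, h2, mul_zero] at h1
  refine ιMulti_ne_zero (dBasis F n) ?_
  rw [← h3, h1]
  simp [kTop, dBasis_apply]

/-- The part of `H_n^t` with `a` even factors. -/
def Kab (F : Type) [Field F] (n t a : ℕ) : Submodule F (KC F n) :=
  Submodule.span F {x | ∃ l : List (Dual F (KV₀ F n) ⊕ Dual F (KV₁ F n)),
    l.length = t ∧
    (∀ h : Dual F (KV₁ F n), Sum.inr h ∈ l → h (Pi.single (Fin.last n) 1) = 0) ∧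
    l.countP Sum.isLeft = a ∧ x = mn l}

theorem count_aux {A B : Type} (l : List (A ⊕ B)) :
    l.countP Sum.isLeft + l.countP Sum.isRight = l.length := by
  induction l with
  | nil => rfl
  | cons a l ih => rcases a with a | a <;> simp [List.countP_cons, ← ih] <;> omega

theorem Kab_le {t a : ℕ} : Kab F n t a ≤ Hn F n t := by
  refine Submodule.span_mono ?_
  rintro x ⟨l, h1, h2, _, h3⟩
  exact ⟨l, h1, h2, h3⟩

theorem Kab_nE {t a : ℕ} {x : KC F n} (hx : x ∈ Kab F n t a) : nE x = (a : F) • x := by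
  induction hx using Submodule.span_induction with
  | mem x hx =>
    obtain ⟨l, h1, h2, rfl, rfl⟩ := hx
    exact nE_mon l
  | zero => simp
  | add x y _ _ hx hy => rw [map_add, hx, hy, smul_add]
  | smul c x _ hx => rw [map_smul, hx, smul_comm]

theorem Kab_nO {t a : ℕ} {x : KC F n} (hx : x ∈ Kab F n t a) : nO x = ((t : F) - a) • x := by
  induction hx using Submodule.span_induction with
  | mem x hx =>
    obtain ⟨l, rfl, h2, rfl, rfl⟩ := hx
    rw [nO_mon l h2, ← count_aux l]
    simp
  | zero => simp
  | add x y _ _ hx hy => rw [map_add, hx, hy, smul_add]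
  | smul c x _ hx => rw [map_smul, hx, smul_comm]

theorem Kab_zero [CharZero F] {t a : ℕ} (ha : n < a) {x : KC F n} (hx : x ∈ Kab F n t a) :
    x = 0 := by
  induction hx using Submodule.span_induction with
  | mem x hx =>
    obtain ⟨l, h1, h2, rfl, rfl⟩ := hx
    obtain ⟨c, l0, l1, h3, h4⟩ := mon_sort (F := F) l
    rw [mn, h4]
    have := evens_zero (F := F) l0 (by omega)
    rw [mn] at this
    rw [this]; simp
  | zero => rfl
  | add x y _ _ hx hy => rw [hx, hy, add_zero]
  | smul c x _ hx => rw [hx, smul_zero]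

theorem all_left {A B : Type} (l : List (A ⊕ B)) (h : l.countP Sum.isLeft = l.length) :
    ∃ l' : List A, l = l'.map Sum.inl := by
  induction l with
  | nil => exact ⟨[], rfl⟩
  | cons a l ih =>
    have h0 := List.countP_le_length (p := Sum.isLeft) (l := l)
    rcases a with a | a
    · obtain ⟨l', rfl⟩ := ih (by simpa [List.countP_cons] using h)
      exact ⟨a :: l', rfl⟩
    · simp at h
      omega

theorem Kab_top [CharZero F] {x : KC F n} (hx : x ∈ Kab F n n n) :
    x ∈ Submodule.span F {kTop F n} := by
  revert x
  change Kab F n n n ≤ _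
  refine Submodule.span_le.mpr ?_
  rintro x ⟨l, h1, h2, h3, rfl⟩
  obtain ⟨l', rfl⟩ := all_left l (by omega)
  exact evens_top l' (by simpa using h1)

theorem Hn_le (t : ℕ) : Hn F n t ≤ ⨆ a ∈ Finset.range (t + 1), Kab F n t a := by
  refine Submodule.span_le.mpr ?_
  rintro x ⟨l, h1, h2, rfl⟩
  have h0 := List.countP_le_length (p := Sum.isLeft) (l := l)
  refine (le_iSup₂_of_le (f := fun a (_ : a ∈ Finset.range (t + 1)) => Kab F n t a)
    (l.countP Sum.isLeft) (Finset.mem_range.mpr (by omega)) le_rfl) ?_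
  exact Submodule.subset_span ⟨l, h1, h2, rfl, rfl⟩

theorem ker_mem [CharZero F] {t : ℕ} {x : KC F n} (hx : x ∈ Hn F n t) (h0 : x * kTau F n = 0)
    (S : Submodule F (KC F n))
    (hS : Submodule.map (LinearMap.mulRight F (kTau F n)) (Hn F n (t - 2)) ⊓
      sdeg F (Dual F (KV₀ F n)) (Dual F (KV₁ F n)) t ≤ S)
    (hS' : t = n → kTop F n ∈ S) : x ∈ S := by
  obtain ⟨μ, hμ⟩ := (Submodule.mem_iSup_finset_iff_exists_sum _ _).mp (Hn_le t hx)
  have h1 : ∀ a ∈ Finset.range (t + 1), (μ a : KC F n) * kTau F n = 0 := by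
    refine eig_aux' nE _ _ ?_ ?_
    · intro a _
      rw [nE_mul, nE_tau, Kab_nE (μ a).2, smul_mul_assoc, add_smul, one_smul, add_comm]
    · rw [← Finset.sum_mul, hμ, h0]
  rw [← hμ]
  refine Submodule.sum_mem _ fun a ha => ?_
  have hm := (μ a).2
  have h2 := h1 a ha
  have hat : a ≤ t := by simpa [Nat.lt_succ_iff] using ha
  generalize (μ a : KC F n) = y at hm h2
  by_cases han : n < a
  · rw [Kab_zero han hm]; exact zero_mem _
  have h3 := hop_tau y
  rw [h2, map_zero, zero_add, Kab_nE hm, Kab_nO hm, ← add_smul] at h3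
  have h4 := sub_smul_aux (F := F) (M := KC F n) h3
  by_cases htop : t = n ∧ a = n
  · obtain ⟨rfl, rfl⟩ := htop
    exact (Submodule.span_le.mpr (by simpa using hS' rfl)) (Kab_top hm)
  · have hne : ((n : F) + (t - a) - a) ≠ 0 := by
      intro h
      have : ((n + t : ℕ) : F) = ((a + a : ℕ) : F) := by push_cast; linear_combination h
      have := Nat.cast_injective this
      omega
    have h5 : y = ((n : F) + (t - a) - a)⁻¹ • (hop y * kTau F n) := by
      rw [← h4, smul_smul, inv_mul_cancel₀ hne, one_smul]
    rw [h5]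
    refine Submodule.smul_mem _ _ (hS ⟨⟨_, hop_mem (Kab_le hm), rfl⟩, ?_⟩)
    rw [← h4]
    exact Submodule.smul_mem _ _ (Hn_le_sdeg t (Kab_le hm))

theorem im_le [CharZero F] (t : ℕ) :
    Submodule.map (LinearMap.mulRight F (kTau F n)) (Hn F n (t - 2)) ⊓
      sdeg F (Dual F (KV₀ F n)) (Dual F (KV₁ F n)) t ≤
    Hn F n t ⊓ LinearMap.ker (LinearMap.mulRight F (kTau F n)) := by
  rintro _ ⟨⟨β, hβ, rfl⟩, hx⟩
  refine ⟨?_, ?_⟩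
  · have h1 : β * kTau F n ∈ Hn F n (t - 2 + 2) := mem_mul_tau hβ
    by_cases ht : t - 2 + 2 = t
    · rw [ht] at h1; exact h1
    · have := sdeg_disj ht (Hn_le_sdeg _ h1) hx
      change β * kTau F n ∈ Hn F n t
      rw [this]; exact zero_mem _
  · simp [mul_assoc, tau_sq]

end Main

theorem stmt19 [CharZero F] (n : ℕ) (hn : 1 ≤ n) (t : ℕ) :
    (t ≠ n →
      Hn F n t ⊓ LinearMap.ker (LinearMap.mulRight F (kTau F n)) =
        Submodule.map (LinearMap.mulRight F (kTau F n)) (Hn F n (t - 2)) ⊓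
          sdeg F (Dual F (KV₀ F n)) (Dual F (KV₁ F n)) t) ∧
    (t = n →
      Hn F n t ⊓ LinearMap.ker (LinearMap.mulRight F (kTau F n)) =
        (Submodule.map (LinearMap.mulRight F (kTau F n)) (Hn F n (t - 2)) ⊓
          sdeg F (Dual F (KV₀ F n)) (Dual F (KV₁ F n)) t) ⊔
          Submodule.span F {kTop F n} ∧
      kTop F n ∉ Submodule.map (LinearMap.mulRight F (kTau F n)) (Hn F n (t - 2))) := by
  refine ⟨fun htn => ?_, fun htn => ⟨?_, ?_⟩⟩
  · refine le_antisymm ?_ (im_le t)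
    rintro x ⟨hx, h0⟩
    exact ker_mem hx (by simpa using h0) _ le_rfl fun h => absurd h htn
  · refine le_antisymm ?_ (sup_le (im_le t) ?_)
    · rintro x ⟨hx, h0⟩
      exact ker_mem hx (by simpa using h0) _ le_sup_left
        fun _ => Submodule.mem_sup_right (Submodule.mem_span_singleton_self _)
    · refine Submodule.span_le.mpr ?_
      rw [Set.singleton_subset_iff]
      refine ⟨htn ▸ kTop_mem, ?_⟩
      simpa using kTop_tau
  · rintro ⟨β, _, h⟩
    exact kTop_not β h
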